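/- Let M ∈ [1,∞), let w be a weight function for M as in the Definition below with derivative bounds |w^{(ν)}(x)| ≤ B_ν M^{-ν} for all x > 0 and all ν ≥ 0, let k ∈ ℤ₊, Δ ∈ ℝ₊, and fix c₁ > 0. For n ∈ ℤ₊ and x > 0 write S(n) = sin(2π (√n / k)(√(x+Δ) − √x)). Then for every ν ∈ ℤ₊ ∪ {0} there is a constant C (depending only on ν, c₁, and B₀, …, B_ν) such that for all a, b, c, d ∈ ℤ₊ with max(a,b,c,d) ≤ c₁ k² M Δ^{-2} and all x ∈ ℝ₊, |d^ν/dx^ν ( w(x) S(a) S(b) S(c) S(d) )| ≤ C (abcd)^{1/2} Δ⁴ k^{-4} M^{-(2+ν)}. -/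

import Mathlib

open scoped Real

/-- `w` is a smooth weight function for `M` with derivative-bound constants `B ν`:
`w ∈ C_c^∞`, `0 ≤ w ≤ 1`, `supp w ⊆ [M/2, 5M/2]`, `w ≡ 1` on `[M, 2M]`, and
`|w^{(ν)}(x)| ≤ B ν · M^{−ν}` for all `x > 0` and all `ν`. -/
def IsWeight (M : ℝ) (B : ℕ → ℝ) (w : ℝ → ℝ) : Prop :=
  ContDiff ℝ (⊤ : ℕ∞) w ∧ HasCompactSupport w ∧
  (∀ x, w x ∈ Set.Icc (0 : ℝ) 1) ∧
  (Function.support w ⊆ Set.Icc (M/2) (5*M/2)) ∧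
  (∀ x ∈ Set.Icc M (2*M), w x = 1) ∧
  (∀ ν : ℕ, ∀ x : ℝ, 0 < x → |iteratedDeriv ν w x| ≤ B ν * M ^ (-(ν : ℝ)))

/-- `S(n) = sin(2π (√n/k)(√(x+Δ) − √x))`. -/
noncomputable def Ssin (k : ℕ) (Δ : ℝ) (n : ℕ) (x : ℝ) : ℝ :=
  Real.sin (2 * Real.pi * (Real.sqrt n / k) * (Real.sqrt (x + Δ) - Real.sqrt x))

open scoped ContDiff in
/-- `f` is smooth at `x` and its `n`-th derivative there is at most `A n * s * r ^ n`. -/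
def DerivBound (A : ℕ → ℝ) (s r : ℝ) (f : ℝ → ℝ) (x : ℝ) : Prop :=
  ContDiffAt ℝ ∞ f x ∧ ∀ n : ℕ, |iteratedDeriv n f x| ≤ A n * s * r ^ n

/-- The binomial convolution of two sequences. -/
def binomConv (A A' : ℕ → ℝ) (n : ℕ) : ℝ :=
  ∑ i ∈ Finset.range (n + 1), (n.choose i : ℝ) * A i * A' (n - i)

/-- Constants in the derivative bounds for `sin (β * h)` in terms of those for `h`. -/
def sinCompConst (q : ℕ → ℝ) (β₀ : ℝ) (n : ℕ) : ℝ :=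
  n.factorial * (1 + q 0 + β₀) ^ (n + 1) * (1 + ∑ i ∈ Finset.range (n + 1), q i) ^ n

/-- Constants in the derivative bounds for `√(x + Δ) - √x`. -/
noncomputable def sqrtDiffConst (n : ℕ) : ℝ :=
  |(descPochhammer ℝ (n + 1)).eval (1 / 2)| * 2 ^ (1 / 2 + n : ℝ)

lemma DerivBound.mul {A A' : ℕ → ℝ} {s t r : ℝ} {f g : ℝ → ℝ} {x : ℝ}
    (hf : DerivBound A s r f x) (hg : DerivBound A' t r g x) :
    DerivBound (binomConv A A') (s * t) r (fun y => f y * g y) x := by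
  refine ⟨hf.1.mul hg.1, fun n => ?_⟩
  rw [iteratedDeriv_fun_mul (hf.1.of_le (by exact_mod_cast le_top))
    (hg.1.of_le (by exact_mod_cast le_top)), binomConv, Finset.sum_mul, Finset.sum_mul]
  refine (Finset.abs_sum_le_sum_abs _ _).trans (Finset.sum_le_sum fun i hi => ?_)
  have hin : i + (n - i) = n := by have := Finset.mem_range.1 hi; omega
  have hmul := mul_le_mul (hf.2 i) (hg.2 (n - i)) (abs_nonneg _) ((abs_nonneg _).trans (hf.2 i))
  rw [abs_mul, abs_mul, Nat.abs_cast, mul_assoc]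
  refine (mul_le_mul_of_nonneg_left hmul (Nat.cast_nonneg _)).trans_eq ?_
  rw [← hin, pow_add, hin]
  ring

open scoped ContDiff in
lemma DerivBound.sin_const_mul {q : ℕ → ℝ} {β β₀ r : ℝ} {h : ℝ → ℝ} {x : ℝ}
    (hq : ∀ n, 0 ≤ q n) (hr : 0 ≤ r) (hβ : 0 ≤ β) (hβ₀ : β ≤ β₀) (hx : 0 < x)
    (hh : ContDiffOn ℝ ∞ h (Set.Ioi 0)) (hb : ∀ n : ℕ, |iteratedDeriv n h x| ≤ q n * r ^ n) :
    DerivBound (sinCompConst q β₀) β r (fun y => Real.sin (β * h y)) x := by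
  have hat : ContDiffAt ℝ ∞ h x := hh.contDiffAt (Ioi_mem_nhds hx)
  refine ⟨Real.contDiff_sin.contDiffAt.comp x (contDiffAt_const.mul hat), fun n => ?_⟩
  set L := 1 + q 0 + β₀ with hL
  set D := 1 + ∑ i ∈ Finset.range (n + 1), q i with hD
  have hL1 : 1 ≤ L := by have := hq 0; linarith
  have hD1 : 1 ≤ D := by
    have := Finset.sum_nonneg fun i (_ : i ∈ Finset.range (n + 1)) => hq i
    linarith
  have houter : ∀ i ≤ n, ‖iteratedFDerivWithin ℝ i (fun u => Real.sin (β * u)) Set.univ (h x)‖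
      ≤ β * L ^ (n + 1) := by
    intro i hi
    rw [iteratedFDerivWithin_univ, norm_iteratedFDeriv_eq_norm_iteratedDeriv,
      iteratedDeriv_comp_const_mul Real.contDiff_sin, Real.norm_eq_abs, abs_mul]
    rcases i with _ | i
    · have h0 : |h x| ≤ q 0 := by simpa using hb 0
      calc |β ^ 0| * |iteratedDeriv 0 Real.sin (β * h x)| ≤ |β * h x| := by
            simpa [abs_mul] using Real.abs_sin_le_abs (x := β * h x)
        _ = β * |h x| := by rw [abs_mul, abs_of_nonneg hβ]
        _ ≤ β * L := by gcongr; linarith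
        _ ≤ β * L ^ (n + 1) := by gcongr; exact le_self_pow₀ hL1 (by omega)
    · calc |β ^ (i + 1)| * |iteratedDeriv (i + 1) Real.sin (β * h x)| ≤ β ^ (i + 1) * 1 := by
            rw [abs_of_nonneg (by positivity)]
            gcongr
            exact Real.abs_iteratedDeriv_sin_le_one _ _
        _ = β * β ^ i := by ring
        _ ≤ β * L ^ i := by have := hq 0; gcongr; linarith
        _ ≤ β * L ^ (n + 1) := by gcongr; omega
  have hinner : ∀ i, 1 ≤ i → i ≤ n →
      ‖iteratedFDerivWithin ℝ i h (Set.Ioi 0) x‖ ≤ (D * r) ^ i := by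
    intro i hi1 hi
    rw [iteratedFDerivWithin_of_isOpen i isOpen_Ioi hx,
      norm_iteratedFDeriv_eq_norm_iteratedDeriv, Real.norm_eq_abs, mul_pow]
    refine (hb i).trans ?_
    gcongr
    have hqi : q i ≤ D := by
      have := Finset.single_le_sum (fun j _ => hq j) (Finset.mem_range.2 (Nat.lt_succ_of_le hi))
      linarith
    exact hqi.trans (le_self_pow₀ hD1 (by omega))
  have key := norm_iteratedFDerivWithin_comp_le (g := fun u => Real.sin (β * u)) (N := ∞)
    (Real.contDiff_sin.comp (contDiff_const.mul contDiff_id)).contDiffOn hh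
    (by exact_mod_cast le_top) uniqueDiffOn_univ isOpen_Ioi.uniqueDiffOn
    (Set.mapsTo_univ _ _) (Set.mem_Ioi.2 hx) houter hinner
  rw [iteratedFDerivWithin_of_isOpen n isOpen_Ioi hx,
    norm_iteratedFDeriv_eq_norm_iteratedDeriv, Real.norm_eq_abs] at key
  refine key.trans_eq ?_
  rw [sinCompConst, mul_pow]
  ring

lemma iteratedDeriv_sqrt (n : ℕ) (x : ℝ) :
    iteratedDeriv n Real.sqrt x
      = (descPochhammer ℝ n).eval (1 / 2) * x ^ (1 / 2 - n : ℝ) := by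
  rw [iteratedDeriv_eq_iterate, ← Real.iter_deriv_rpow_const, funext Real.sqrt_eq_rpow]

open scoped ContDiff in
lemma contDiffOn_sqrt_add {Δ : ℝ} (hΔ : 0 ≤ Δ) :
    ContDiffOn ℝ ∞ (fun y => Real.sqrt (y + Δ)) (Set.Ioi 0) :=
  (contDiff_id.add contDiff_const).contDiffOn.sqrt fun y hy => by
    have := Set.mem_Ioi.1 hy
    simp only [id]
    positivity

open scoped ContDiff in
lemma contDiffOn_sqrt_diff {Δ : ℝ} (hΔ : 0 ≤ Δ) :
    ContDiffOn ℝ ∞ (fun y => Real.sqrt (y + Δ) - Real.sqrt y) (Set.Ioi 0) := by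
  simpa using (contDiffOn_sqrt_add hΔ).sub (contDiffOn_sqrt_add le_rfl)

lemma abs_iteratedDeriv_sqrt_diff_le {M Δ x : ℝ} (hM : 0 < M) (hΔ : 0 ≤ Δ) (hx : M / 2 ≤ x)
    (n : ℕ) :
    |iteratedDeriv n (fun y => Real.sqrt (y + Δ) - Real.sqrt y) x|
      ≤ Δ / Real.sqrt M * (sqrtDiffConst n * M⁻¹ ^ n) := by
  have hx0 : 0 < x := by linarith
  have hsub : iteratedDeriv n (fun y => Real.sqrt (y + Δ) - Real.sqrt y) x
      = iteratedDeriv n Real.sqrt (x + Δ) - iteratedDeriv n Real.sqrt x := by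
    have h1 := (contDiffOn_sqrt_add hΔ).contDiffAt (Ioi_mem_nhds hx0)
    have h2 := Real.contDiffAt_sqrt (n := n) hx0.ne'
    rw [← congrFun (iteratedDeriv_comp_add_const n Real.sqrt Δ) x]
    exact iteratedDeriv_sub (h1.of_le (by exact_mod_cast le_top)) h2
  have hdiff : ∀ y ∈ Set.Ici x, DifferentiableAt ℝ (iteratedDeriv n Real.sqrt) y := by
    intro y hy
    have hy0 : y ≠ 0 := (hx0.trans_le hy).ne'
    rw [funext (iteratedDeriv_sqrt n)]
    exact (Real.differentiableAt_rpow_const_of_ne _ hy0).const_mul _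
  have hderiv : ∀ y ∈ Set.Ici x, ‖deriv (iteratedDeriv n Real.sqrt) y‖
      ≤ sqrtDiffConst n * ((Real.sqrt M)⁻¹ * M⁻¹ ^ n) := by
    intro y hy
    have hy' : M / 2 ≤ y := hx.trans hy
    rw [← iteratedDeriv_succ, iteratedDeriv_sqrt, norm_mul, Real.norm_eq_abs, sqrtDiffConst,
      mul_assoc, Real.norm_of_nonneg (Real.rpow_nonneg (by linarith) _)]
    gcongr
    calc y ^ (1 / 2 - (n + 1 : ℕ) : ℝ) ≤ (M / 2) ^ (1 / 2 - (n + 1 : ℕ) : ℝ) := by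
          refine Real.rpow_le_rpow_of_nonpos (by positivity) hy' ?_
          push_cast
          have : (0 : ℝ) ≤ n := n.cast_nonneg
          linarith
      _ = 2 ^ (1 / 2 + n : ℝ) * ((Real.sqrt M)⁻¹ * M⁻¹ ^ n) := by
          have he : (1 / 2 - (n + 1 : ℕ) : ℝ) = -(1 / 2 + n) := by push_cast; ring
          rw [he, Real.div_rpow hM.le zero_le_two, Real.rpow_neg hM.le,
            Real.rpow_neg zero_le_two, Real.rpow_add hM, Real.rpow_natCast, Real.sqrt_eq_rpow,
            div_inv_eq_mul, mul_inv, inv_pow]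
          ring
  have key := (convex_Ici x).norm_image_sub_le_of_norm_deriv_le hdiff hderiv
    (Set.mem_Ici.2 le_rfl) (Set.mem_Ici.2 (le_add_of_nonneg_right hΔ))
  rw [hsub, ← Real.norm_eq_abs]
  refine key.trans_eq ?_
  rw [add_sub_cancel_left, Real.norm_of_nonneg hΔ]
  ring

lemma Ssin_derivBound {c₁ M Δ x : ℝ} {k a : ℕ} (hM : 0 < M) (hΔ : 0 < Δ) (hk : 0 < k)
    (ha : (a : ℝ) ≤ c₁ * (k : ℝ) ^ 2 * M / Δ ^ 2) (hx : M / 2 ≤ x) :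
    DerivBound (sinCompConst sqrtDiffConst (2 * π * Real.sqrt c₁))
      (2 * π * (Real.sqrt a * Δ / (k * Real.sqrt M))) M⁻¹ (Ssin k Δ a) x := by
  have hk' : (0 : ℝ) < k := Nat.cast_pos.2 hk
  have hsM : 0 < Real.sqrt M := Real.sqrt_pos.2 hM
  have hβ₀ : Real.sqrt a * Δ / (k * Real.sqrt M) ≤ Real.sqrt c₁ := by
    refine Real.le_sqrt_of_sq_le ?_
    rw [div_pow, mul_pow, mul_pow, Real.sq_sqrt a.cast_nonneg, Real.sq_sqrt hM.le,
      div_le_iff₀ (by positivity), ← mul_assoc]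
    exact (le_div_iff₀ (by positivity)).1 ha
  have hfun : Ssin k Δ a = fun y => Real.sin (2 * π * (Real.sqrt a * Δ / (k * Real.sqrt M)) *
      (Real.sqrt M / Δ * (Real.sqrt (y + Δ) - Real.sqrt y))) := by
    funext y
    rw [Ssin]
    congr 1
    field_simp
  rw [hfun]
  refine DerivBound.sin_const_mul (fun n => by unfold sqrtDiffConst; positivity) (by positivity)
    (by positivity) (by gcongr) (by linarith)
    (contDiffOn_const.mul (contDiffOn_sqrt_diff hΔ.le)) fun n => ?_
  rw [iteratedDeriv_const_mul_field, abs_mul, abs_of_nonneg (by positivity)]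
  calc _ ≤ Real.sqrt M / Δ * (Δ / Real.sqrt M * (sqrtDiffConst n * M⁻¹ ^ n)) := by
        gcongr
        exact abs_iteratedDeriv_sqrt_diff_le hM hΔ.le hx n
    _ = sqrtDiffConst n * M⁻¹ ^ n := by field_simp

lemma IsWeight.derivBound {M : ℝ} {B : ℕ → ℝ} {w : ℝ → ℝ} (hw : IsWeight M B w)
    (hM : 0 < M) {x : ℝ} (hx : 0 < x) : DerivBound B 1 M⁻¹ w x := by
  refine ⟨hw.1.contDiffAt, fun n => ?_⟩
  have hn := hw.2.2.2.2.2 n x hx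
  rwa [Real.rpow_neg hM.le, Real.rpow_natCast, ← inv_pow, ← mul_one (B n)] at hn

/-- Lemma 8: derivative bounds for `w(x) S(a) S(b) S(c) S(d)`. -/
theorem sine_product_derivative_bound
    (ν : ℕ) (c₁ : ℝ) (hc₁ : 0 < c₁) (B : ℕ → ℝ) :
    ∃ C : ℝ, 0 < C ∧ ∀ (M Δ : ℝ) (k : ℕ) (w : ℝ → ℝ),
      1 ≤ M → 0 < Δ → 0 < k → IsWeight M B w →
      ∀ a b c d : ℕ, 0 < a → 0 < b → 0 < c → 0 < d →
        (a : ℝ) ≤ c₁ * (k : ℝ)^2 * M / Δ^2 → (b : ℝ) ≤ c₁ * (k : ℝ)^2 * M / Δ^2 →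
        (c : ℝ) ≤ c₁ * (k : ℝ)^2 * M / Δ^2 → (d : ℝ) ≤ c₁ * (k : ℝ)^2 * M / Δ^2 →
        ∀ x : ℝ, 0 < x →
          |iteratedDeriv ν
              (fun y => w y * Ssin k Δ a y * Ssin k Δ b y * Ssin k Δ c y * Ssin k Δ d y) x|
            ≤ C * ((a : ℝ) * b * c * d) ^ ((1 : ℝ)/2) * Δ^4 / ((k : ℝ)^4 * M ^ ((2 : ℝ) + ν)) := by
  set A := sinCompConst sqrtDiffConst (2 * π * Real.sqrt c₁)
  set K := binomConv (binomConv (binomConv (binomConv B A) A) A) A ν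
  refine ⟨|K| * (2 * π) ^ 4 + 1, by positivity, ?_⟩
  intro M Δ k w hM hΔ hk hw a b c d _ _ _ _ ha hb hc hd x hx
  have hM0 : 0 < M := by linarith
  rcases lt_or_ge x (M / 2) with hxM | hxM
  · have hev : (fun y => w y * Ssin k Δ a y * Ssin k Δ b y * Ssin k Δ c y * Ssin k Δ d y)
        =ᶠ[nhds x] fun _ => 0 := by
      filter_upwards [Iio_mem_nhds hxM] with y hy
      have hwy : w y = 0 := by
        by_contra hne
        exact absurd (hw.2.2.2.1 hne).1 (not_le.2 hy)
      simp [hwy]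
    rw [hev.iteratedDeriv_eq, iteratedDeriv_fun_const_zero, abs_zero]
    positivity
  · have key := (((((hw.derivBound hM0 hx).mul (Ssin_derivBound hM0 hΔ hk ha hxM)).mul
      (Ssin_derivBound hM0 hΔ hk hb hxM)).mul (Ssin_derivBound hM0 hΔ hk hc hxM)).mul
      (Ssin_derivBound hM0 hΔ hk hd hxM)).2 ν
    set Q := ((a : ℝ) * b * c * d) ^ ((1 : ℝ) / 2) * Δ ^ 4 / ((k : ℝ) ^ 4 * M ^ ((2 : ℝ) + ν))
      with hQ
    have hQ0 : 0 ≤ Q := by positivity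
    have hscale : 1 * (2 * π * (Real.sqrt a * Δ / (k * Real.sqrt M)))
        * (2 * π * (Real.sqrt b * Δ / (k * Real.sqrt M)))
        * (2 * π * (Real.sqrt c * Δ / (k * Real.sqrt M)))
        * (2 * π * (Real.sqrt d * Δ / (k * Real.sqrt M))) * M⁻¹ ^ ν = (2 * π) ^ 4 * Q := by
      have hM4 : Real.sqrt M ^ 4 = M ^ 2 := by
        rw [show 4 = 2 * 2 from rfl, pow_mul, Real.sq_sqrt hM0.le]
      rw [hQ, ← Real.sqrt_eq_rpow, Real.sqrt_mul (by positivity), Real.sqrt_mul (by positivity),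
        Real.sqrt_mul (by positivity), Real.rpow_add hM0, Real.rpow_natCast, Real.rpow_two, ← hM4,
        inv_pow]
      field_simp
    calc _ ≤ K * ((2 * π) ^ 4 * Q) := by rw [← hscale, ← mul_assoc]; exact key
      _ ≤ |K| * ((2 * π) ^ 4 * Q) := by gcongr; exact le_abs_self K
      _ ≤ (|K| * (2 * π) ^ 4 + 1) * Q := by nlinarith
      _ = _ := by rw [hQ]; ring
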